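/- Every scheme X proper over a Noetherian base scheme Y admits a projective envelope: there exists a scheme Z projective over Y and an envelope f : Z → X over Y. -/

import Mathlib

open CategoryTheory AlgebraicGeometry Limits

attribute [local instance] MvPolynomial.gradedAlgebra

/-- A morphism of schemes is *birational onto its target* if it restricts to an
isomorphism over a dense open subset of the target. -/
def IsBirationalOnto {W' W : Scheme} (g : W' ⟶ W) : Prop :=
  ∃ U : W.Opens, Dense (U : Set W) ∧ IsIso (g ∣_ U)

/-- A proper morphism `f : Z ⟶ X` is an *envelope* if every integral closed
subscheme `W` of `X` is the birational image of an integral closed subscheme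
`W'` of `Z`. -/
def IsEnvelope {Z X : Scheme} (f : Z ⟶ X) : Prop :=
  IsProper f ∧
  ∀ (W : Scheme) (ι : W ⟶ X), IsClosedImmersion ι → IsIntegral W →
    ∃ (W' : Scheme) (ι' : W' ⟶ Z) (g : W' ⟶ W),
      IsClosedImmersion ι' ∧ IsIntegral W' ∧ ι' ≫ f = g ≫ ι ∧ IsBirationalOnto g

/-- A scheme `X` (with structure morphism `s`) is separated and of finite type
over a field `k`. -/
def IsFiniteTypeOverField {X : Scheme} (k : Type) [Field k]
    (s : X ⟶ Spec (CommRingCat.of k)) : Prop :=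
  IsSeparated s ∧ LocallyOfFiniteType s ∧ QuasiCompact s

/-- Projective `n`-space over `ℤ`, as `Proj` of the polynomial ring
`ℤ[x₀, …, xₙ]` with its standard grading. -/
noncomputable def ProjSpace (n : ℕ) : Scheme :=
  Proj (MvPolynomial.homogeneousSubmodule (Fin (n + 1)) ℤ)

/-- A morphism `f : Z ⟶ Y` of schemes is *projective* if it factors through a
closed immersion into some relative projective space
`ℙ^n_Y = ℙ^n_ℤ ×_{Spec ℤ} Y` over `Y`. -/
noncomputable def IsProjectiveMorphism {Z Y : Scheme} (f : Z ⟶ Y) : Prop :=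
  ∃ (n : ℕ)
    (i : Z ⟶ pullback (terminal.from (ProjSpace n)) (terminal.from Y)),
      IsClosedImmersion i ∧ i ≫ pullback.snd _ _ = f

lemma AlgebraicGeometry.Scheme.IdealSheafData.isReduced_subscheme {X : Scheme}
    (I : X.IdealSheafData) (h : ∀ U, (I.ideal U).IsRadical) : IsReduced I.subscheme := by
  have (i : X.affineOpens) : IsReduced (I.subschemeCover.openCover.X i) := by
    have : _root_.IsReduced (Γ(X, (i : X.affineOpens).1) ⧸ I.ideal i) :=
      (Ideal.isRadical_iff_quotient_reduced _).mp (h i)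
    change IsReduced (Spec (.of (Γ(X, (i : X.affineOpens).1) ⧸ I.ideal i)))
    infer_instance
  have (i : I.subschemeCover.openCover.I₀) : IsReduced (I.subschemeCover.openCover.X i) := this i
  exact AlgebraicGeometry.IsReduced.of_openCover _ I.subschemeCover.openCover

lemma AlgebraicGeometry.Scheme.Hom.isRadical_ker {X Y : Scheme} (f : X ⟶ Y) [QuasiCompact f]
    [IsReduced X] (U : Y.affineOpens) : (f.ker.ideal U).IsRadical := by
  rw [f.ker_apply]
  exact (Ideal.isRadical_bot (R := Γ(X, f ⁻¹ᵁ U))).comap (f.app U).hom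

lemma AlgebraicGeometry.IsClosedImmersion.exists_lift_of_isReduced {X Y Z : Scheme}
    (f : X ⟶ Z) (g : Y ⟶ Z) [IsClosedImmersion f] [QuasiCompact g] [IsReduced Y]
    (h : Set.range g ⊆ Set.range f) : ∃ l : Y ⟶ X, l ≫ f = g := by
  have hg : g.ker.radical = g.ker := by
    ext U : 2
    exact (g.isRadical_ker U).radical
  have : f.ker ≤ g.ker := by
    rw [← hg, ← Scheme.IdealSheafData.vanishingIdeal_support,
      ← Scheme.IdealSheafData.le_support_iff_le_vanishingIdeal, ← SetLike.coe_subset_coe,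
      Scheme.Hom.support_ker, Scheme.Hom.support_ker]
    exact closure_mono h
  exact ⟨IsClosedImmersion.lift f g this, IsClosedImmersion.lift_fac _ _ _⟩

lemma AlgebraicGeometry.Scheme.Hom.isIntegral_image {X Y : Scheme} (f : X ⟶ Y) [QuasiCompact f]
    [IsIntegral X] : IsIntegral f.image := by
  have : IsReduced f.image := f.ker.isReduced_subscheme f.isRadical_ker
  have : IrreducibleSpace f.image := by
    rw [irreducibleSpace_def]
    convert!
      ((IrreducibleSpace.isIrreducible_univ X).image _
          f.toImage.continuous.continuousOn).closure
    simpa using f.toImage.denseRange.closure_range.symm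
  exact isIntegral_of_irreducibleSpace_of_isReduced _

/-- The closure of a section over an open subscheme of an integral scheme is birational onto
that scheme. -/
lemma isBirationalOnto_image {W M : Scheme} (g : M ⟶ W) [IsSeparated g]
    [IsIntegral W] (U : W.Opens) [Nonempty U] (s : U.toScheme ⟶ M) [QuasiCompact s]
    (hs : s ≫ g = U.ι) : IsBirationalOnto (s.imageι ≫ g) := by
  have : IsIntegral s.image := s.isIntegral_image
  refine ⟨U, U.isOpen.dense (Set.nonempty_coe_sort.mp ‹_›), ?_⟩
  set h := s.imageι ≫ g with hh
  have hsh : s.toImage ≫ h = U.ι := by simp [hh, hs]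
  let t : U.toScheme ⟶ (h ⁻¹ᵁ U).toScheme := IsOpenImmersion.lift (h ⁻¹ᵁ U).ι s.toImage (by
    rintro _ ⟨x, rfl⟩
    simp only [Scheme.Opens.range_ι, SetLike.mem_coe, Scheme.Hom.mem_preimage]
    rw [← Scheme.Hom.comp_apply, hsh]
    exact x.2)
  have ht : t ≫ (h ⁻¹ᵁ U).ι = s.toImage := IsOpenImmersion.lift_fac _ _ _
  have ht' : t ≫ h ∣_ U = 𝟙 _ := by
    rw [← cancel_mono U.ι]
    rw [Category.assoc, morphismRestrict_ι, reassoc_of% ht, hsh, Category.id_comp]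
  have : IsClosedImmersion (t ≫ h ∣_ U) := ht' ▸ inferInstance
  have : IsClosedImmersion t := .of_comp t (h ∣_ U)
  have : IsDominant (t ≫ (h ⁻¹ᵁ U).ι) := ht ▸ inferInstance
  have hd : DenseRange t := by
    have hd := this.denseRange
    rw [Scheme.Hom.comp_base] at hd
    rw [DenseRange, (h ⁻¹ᵁ U).ι.isOpenEmbedding.isInducing.dense_iff]
    intro x
    have := hd ((h ⁻¹ᵁ U).ι x)
    rwa [← Set.range_comp]
  have : Surjective t := ⟨by
    rw [← Set.range_eq_univ, ← t.isClosedEmbedding.isClosed_range.closure_eq]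
    exact hd.closure_range⟩
  have : IsIso t := isIso_of_isClosedImmersion_of_surjective t
  rw [show h ∣_ U = inv t by rw [← cancel_epi t, ht']; simp]
  infer_instance

lemma AlgebraicGeometry.mono_of_iSup_preimage_eq_top {Z P : Scheme} (b : Z ⟶ P) {κ : Type}
    (O : κ → P.Opens) (hO : ⨆ k, b ⁻¹ᵁ O k = ⊤) (h : ∀ k, Mono ((b ⁻¹ᵁ O k).ι ≫ b)) :
    Mono b := by
  refine ⟨fun {S} s t hst ↦ ?_⟩
  have hcov : ⨆ k, s ⁻¹ᵁ (b ⁻¹ᵁ O k) = ⊤ := by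
    rw [← Scheme.Hom.preimage_iSup, hO, Scheme.Hom.preimage_top]
  refine (S.openCoverOfIsOpenCover _ hcov).hom_ext _ _ fun (k : κ) ↦ ?_
  change (s ⁻¹ᵁ (b ⁻¹ᵁ O k)).ι ≫ s = (s ⁻¹ᵁ (b ⁻¹ᵁ O k)).ι ≫ t
  have key (r : S ⟶ Z) (hr : r ≫ b = s ≫ b) : ∃ r' : (s ⁻¹ᵁ (b ⁻¹ᵁ O k)).toScheme ⟶ b ⁻¹ᵁ O k,
      r' ≫ (b ⁻¹ᵁ O k).ι = (s ⁻¹ᵁ (b ⁻¹ᵁ O k)).ι ≫ r := by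
    refine ⟨IsOpenImmersion.lift (b ⁻¹ᵁ O k).ι _ ?_, IsOpenImmersion.lift_fac _ _ _⟩
    rintro _ ⟨x, rfl⟩
    rw [Scheme.Opens.range_ι, SetLike.mem_coe, Scheme.Hom.mem_preimage, ← Scheme.Hom.comp_apply,
      Category.assoc, hr]
    exact x.2
  obtain ⟨s', hs'⟩ := key s rfl
  obtain ⟨t', ht'⟩ := key t hst.symm
  have := h k
  have e : s' ≫ (b ⁻¹ᵁ O k).ι ≫ b = t' ≫ (b ⁻¹ᵁ O k).ι ≫ b := by
    rw [reassoc_of% hs', reassoc_of% ht', hst]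
  rw [← hs', ← ht', (cancel_mono ((b ⁻¹ᵁ O k).ι ≫ b)).mp e]

lemma AlgebraicGeometry.isClosedImmersion_coprodDesc {Z₁ Z₂ P : Scheme} (f : Z₁ ⟶ P) (g : Z₂ ⟶ P)
    [IsClosedImmersion f] [IsClosedImmersion g] (h : Disjoint (Set.range f) (Set.range g)) :
    IsClosedImmersion (coprod.desc f g) := by
  have hl (x : Z₁) : coprod.desc f g ((coprod.inl : Z₁ ⟶ Z₁ ⨿ Z₂) x) = f x := by
    rw [← Scheme.Hom.comp_apply, coprod.inl_desc]
  have hr (x : Z₂) : coprod.desc f g ((coprod.inr : Z₂ ⟶ Z₁ ⨿ Z₂) x) = g x := by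
    rw [← Scheme.Hom.comp_apply, coprod.inr_desc]
  have hclosed : IsClosedMap (coprod.desc f g) := (coprod.desc f g).isClosedMap
  have hinj : Function.Injective (coprod.desc f g) := by
    intro x y hxy
    obtain ⟨(x | x), rfl⟩ := (coprodMk Z₁ Z₂).surjective x <;>
    obtain ⟨(y | y), rfl⟩ := (coprodMk Z₁ Z₂).surjective y <;>
    simp only [coprodMk_inl, coprodMk_inr, hl, hr] at hxy ⊢
    · rw [f.isClosedEmbedding.injective hxy]
    · exact (Set.disjoint_left.mp h ⟨x, rfl⟩ ⟨y, hxy.symm⟩).elim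
    · exact (Set.disjoint_left.mp h ⟨y, rfl⟩ ⟨x, hxy⟩).elim
    · rw [g.isClosedEmbedding.injective hxy]
  have hs : SurjectiveOnStalks (coprod.desc f g) := by
    rw [IsZariskiLocalAtSource.iff_of_openCover (P := @SurjectiveOnStalks)
      (coprodOpenCover.{_, 0} Z₁ Z₂)]
    rintro (_ | _)
    · change SurjectiveOnStalks (coprod.inl ≫ coprod.desc f g)
      rw [coprod.inl_desc]; infer_instance
    · change SurjectiveOnStalks (coprod.inr ≫ coprod.desc f g)
      rw [coprod.inr_desc]; infer_instance
  rw [IsClosedImmersion.iff_isPreimmersion]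
  exact ⟨⟨(Topology.IsClosedEmbedding.of_continuous_injective_isClosedMap
    (coprod.desc f g).continuous hinj hclosed).isEmbedding⟩, hclosed.isClosed_range⟩

namespace ProjSpace

open MvPolynomial

instance finiteType_homogeneousSubmodule_zero (σ : Type) [Finite σ] :
    Algebra.FiniteType (homogeneousSubmodule σ ℤ 0) (MvPolynomial σ ℤ) :=
  have : IsScalarTower ℤ (homogeneousSubmodule σ ℤ 0) (MvPolynomial σ ℤ) :=
    ⟨fun x y z ↦ by
      simp only [Algebra.smul_def, ← mul_assoc]
      congr 1
      exact zsmul_eq_mul (y : MvPolynomial σ ℤ) x⟩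
  .of_restrictScalars_finiteType ℤ _ _

instance isProper_terminal_from (n : ℕ) : IsProper (terminal.from (ProjSpace n)) := by
  let φ : ℤ →+* homogeneousSubmodule (Fin (n + 1)) ℤ 0 := algebraMap _ _
  have hφ : Function.Surjective φ := by
    rintro ⟨x, hx⟩
    obtain ⟨a, rfl⟩ : ∃ a, C a = x := by
      rw [homogeneousSubmodule_zero, Submodule.mem_one] at hx
      exact hx
    exact ⟨a, rfl⟩
  have : IsClosedImmersion (Spec.map (CommRingCat.ofHom φ)) :=
    IsClosedImmersion.spec_of_surjective _ hφ
  have : IsIso (terminal.from (Spec (CommRingCat.of ℤ))) :=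
    (specZIsTerminal.uniqueUpToIso terminalIsTerminal).isIso_hom
  have : IsProper (Proj.toSpecZero (homogeneousSubmodule (Fin (n + 1)) ℤ)) := inferInstance
  rw [show terminal.from (ProjSpace n) =
    (Proj.toSpecZero (homogeneousSubmodule (Fin (n + 1)) ℤ) ≫ Spec.map (CommRingCat.ofHom φ)) ≫
      terminal.from (Spec (CommRingCat.of ℤ)) from terminal.hom_ext _ _]
  have h1 : IsProper (Proj.toSpecZero (homogeneousSubmodule (Fin (n + 1)) ℤ) ≫
      Spec.map (CommRingCat.ofHom φ)) := inferInstance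
  have h2 : IsProper (terminal.from (Spec (CommRingCat.of ℤ))) := inferInstance
  exact MorphismProperty.comp_mem _ _ _ h1 h2

/-- The standard affine open `D₊(xᵢ)` of projective space. -/
noncomputable def chart {n : ℕ} (i : Fin (n + 1)) : (ProjSpace n).Opens :=
  Proj.basicOpen (homogeneousSubmodule (Fin (n + 1)) ℤ) (X i)

lemma irrelevant_le_span_X (n : ℕ) :
    (HomogeneousIdeal.irrelevant (homogeneousSubmodule (Fin (n + 1)) ℤ)).toIdeal ≤
      Ideal.span (Set.range X) := by
  rw [HomogeneousIdeal.toIdeal_irrelevant_le]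
  intro i hi x hx
  have hx : x.IsHomogeneous i := hx
  change x ∈ Ideal.span (Set.range X)
  rw [← Set.image_univ, mem_ideal_span_X_image]
  intro m hm
  by_contra! hc
  have hm0 : m = 0 := by ext k; simpa using hc k
  have := hx (mem_support_iff.mp hm)
  simp [hm0] at this
  omega

lemma iSup_chart (n : ℕ) : ⨆ i : Fin (n + 1), chart i = ⊤ :=
  Proj.iSup_basicOpen_eq_top _ _ (irrelevant_le_span_X n)

/-- The graded ring homomorphism killing the variables outside the range of `e`. -/
noncomputable def killComplGraded {n m : ℕ} (e : Fin (n + 1) ↪ Fin (m + 1)) :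
    homogeneousSubmodule (Fin (m + 1)) ℤ →+*ᵍ homogeneousSubmodule (Fin (n + 1)) ℤ where
  __ := (killCompl (R := ℤ) e.injective).toRingHom
  map_mem {i x} hx := by
    classical
    have hx : x.IsHomogeneous i := hx
    have := hx.aeval (S := ℤ) (τ := Fin (n + 1)) (n := 1) (fun j ↦
      if h : j ∈ Set.range e then X ((Equiv.ofInjective e e.injective).symm ⟨j, h⟩) else 0) (by
        intro j
        split_ifs
        · exact isHomogeneous_X _ _
        · exact isHomogeneous_zero _ _ _)
    rw [one_mul] at this
    change (killCompl (R := ℤ) e.injective x).IsHomogeneous i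
    unfold killCompl
    convert this

@[simp] lemma killComplGraded_X_apply {n m : ℕ} (e : Fin (n + 1) ↪ Fin (m + 1)) (i) :
    killComplGraded e (X (e i)) = X i := by
  change killCompl (R := ℤ) e.injective (X (e i)) = X i
  rw [← rename_X, killCompl_rename_app]

lemma killComplGraded_rename {n m : ℕ} (e : Fin (n + 1) ↪ Fin (m + 1))
    (x : MvPolynomial (Fin (n + 1)) ℤ) :
    killComplGraded e (rename e x) = x :=
  killCompl_rename_app e.injective x

lemma killComplGraded_X_of_notMem {n m : ℕ} (e : Fin (n + 1) ↪ Fin (m + 1)) (j)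
    (hj : j ∉ Set.range e) : killComplGraded e (X j) = 0 := by
  change killCompl (R := ℤ) e.injective (X j) = 0
  simp only [killCompl, aeval_X]
  exact dif_neg hj

lemma irrelevant_le_map_killComplGraded {n m : ℕ} (e : Fin (n + 1) ↪ Fin (m + 1)) :
    HomogeneousIdeal.irrelevant (homogeneousSubmodule (Fin (n + 1)) ℤ) ≤
      (HomogeneousIdeal.irrelevant (homogeneousSubmodule (Fin (m + 1)) ℤ)).map
        (killComplGraded e) := by
  rw [← toIdeal_le_toIdeal_iff]
  refine (irrelevant_le_span_X n).trans ?_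
  rw [Ideal.span_le]
  rintro _ ⟨i, rfl⟩
  rw [← killComplGraded_X_apply e]
  exact Ideal.mem_map_of_mem _
    (HomogeneousIdeal.mem_irrelevant_of_mem _ one_pos (isHomogeneous_X ℤ (e i)))

/-- The inclusion of a coordinate linear subspace. -/
noncomputable def linear {n m : ℕ} (e : Fin (n + 1) ↪ Fin (m + 1)) : ProjSpace n ⟶ ProjSpace m :=
  Proj.map (killComplGraded e) (irrelevant_le_map_killComplGraded e)

lemma linear_preimage_chart {n m : ℕ} (e : Fin (n + 1) ↪ Fin (m + 1)) (j) :
    linear e ⁻¹ᵁ chart j =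
      Proj.basicOpen (homogeneousSubmodule (Fin (n + 1)) ℤ) (killComplGraded e (X j)) :=
  rfl

lemma linear_preimage_chart_of_notMem {n m : ℕ} (e : Fin (n + 1) ↪ Fin (m + 1)) (j)
    (hj : j ∉ Set.range e) : linear e ⁻¹ᵁ chart j = ⊥ := by
  rw [linear_preimage_chart, killComplGraded_X_of_notMem e j hj, Proj.basicOpen_zero]
  rfl

lemma away_map_killComplGraded_surjective {n m : ℕ} (e : Fin (n + 1) ↪ Fin (m + 1)) (j) :
    Function.Surjective (HomogeneousLocalization.Away.map (killComplGraded e) (X j)) := by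
  intro z
  have hX : X j ∈ homogeneousSubmodule (Fin (m + 1)) ℤ 1 := isHomogeneous_X ℤ j
  obtain ⟨k, a, ha, rfl⟩ := HomogeneousLocalization.Away.mk_surjective _
    ((killComplGraded e).map_mem hX) z
  have ha' : rename e a ∈ homogeneousSubmodule (Fin (m + 1)) ℤ (k • 1) :=
    IsHomogeneous.rename_isHomogeneous ha
  refine ⟨.mk _ hX k (rename e a) ha', ?_⟩
  rw [HomogeneousLocalization.Away.map_mk]
  congr 1
  exact killComplGraded_rename e a

instance mono_linear {n m : ℕ} (e : Fin (n + 1) ↪ Fin (m + 1)) : Mono (linear e) := by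
  refine mono_of_iSup_preimage_eq_top _ chart ?_ fun j ↦ ?_
  · rw [← Scheme.Hom.preimage_iSup, iSup_chart, Scheme.Hom.preimage_top]
  · have hX : X j ∈ homogeneousSubmodule (Fin (m + 1)) ℤ 1 := isHomogeneous_X ℤ j
    have hs : Mono (Spec.map (CommRingCat.ofHom
        (HomogeneousLocalization.Away.map (killComplGraded e) (X j)))) :=
      have := IsClosedImmersion.spec_of_surjective (CommRingCat.ofHom
        (HomogeneousLocalization.Away.map (killComplGraded e) (X j)))
        (away_map_killComplGraded_surjective e j)
      inferInstance
    have h := Proj.awayι_comp_map (killComplGraded e) (irrelevant_le_map_killComplGraded e)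
      one_pos (X j) hX
    rw [Proj.awayι, Category.assoc, Iso.inv_comp_eq] at h
    have : (linear e ⁻¹ᵁ chart j).ι ≫ linear e = _ := h
    rw [this]
    have := mono_comp (Spec.map (CommRingCat.ofHom
      (HomogeneousLocalization.Away.map (killComplGraded e) (X j))))
      (Proj.awayι (homogeneousSubmodule (Fin (m + 1)) ℤ) (X j) hX one_pos)
    have hiso {S T : Scheme} (i : S ≅ T) : Mono i.hom := inferInstance
    exact @mono_comp _ _ _ _ _ _ (hiso _) _ this

instance isClosedImmersion_linear {n m : ℕ} (e : Fin (n + 1) ↪ Fin (m + 1)) :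
    IsClosedImmersion (linear e) := by
  have : IsProper (linear e) := by
    have : IsProper (linear e ≫ terminal.from _) := by
      rw [terminal.comp_from]; infer_instance
    exact .of_comp _ (terminal.from _)
  exact (IsClosedImmersion.iff_isProper_and_mono _).mpr ⟨this, inferInstance⟩

lemma disjoint_range_linear {n₁ n₂ m : ℕ} (e₁ : Fin (n₁ + 1) ↪ Fin (m + 1))
    (e₂ : Fin (n₂ + 1) ↪ Fin (m + 1)) (h : Disjoint (Set.range e₁) (Set.range e₂)) :
    Disjoint (Set.range (linear e₁)) (Set.range (linear e₂)) := by
  rw [Set.disjoint_left]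
  rintro x ⟨y, rfl⟩ ⟨z, hz⟩
  obtain ⟨j, hj⟩ := TopologicalSpace.Opens.mem_iSup.mp
    ((iSup_chart m).ge (TopologicalSpace.Opens.mem_top (linear e₁ y)))
  by_cases h₁ : j ∈ Set.range e₁
  · have : z ∈ linear e₂ ⁻¹ᵁ chart j := by rwa [Scheme.Hom.mem_preimage, hz]
    rw [linear_preimage_chart_of_notMem _ _ (Set.disjoint_left.mp h h₁)] at this
    exact this
  · have : y ∈ linear e₁ ⁻¹ᵁ chart j := hj
    rw [linear_preimage_chart_of_notMem _ _ h₁] at this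
    exact this

end ProjSpace

namespace IsProjectiveMorphism

lemma isProper {Z Y : Scheme} {q : Z ⟶ Y} (h : IsProjectiveMorphism q) : IsProper q := by
  obtain ⟨n, i, hi, rfl⟩ := h
  infer_instance

lemma coprodDesc {Z₁ Z₂ Y : Scheme} {q₁ : Z₁ ⟶ Y} {q₂ : Z₂ ⟶ Y}
    (h₁ : IsProjectiveMorphism q₁) (h₂ : IsProjectiveMorphism q₂) :
    IsProjectiveMorphism (coprod.desc q₁ q₂) := by
  obtain ⟨n₁, i₁, hi₁, rfl⟩ := h₁
  obtain ⟨n₂, i₂, hi₂, rfl⟩ := h₂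
  let e₁ : Fin (n₁ + 1) ↪ Fin (n₁ + 1 + n₂ + 1) := Fin.castAddEmb (n₂ + 1)
  let e₂ : Fin (n₂ + 1) ↪ Fin (n₁ + 1 + n₂ + 1) := Fin.natAddEmb (n₁ + 1)
  have he : Disjoint (Set.range e₁) (Set.range e₂) := by
    rw [Set.disjoint_left]
    rintro _ ⟨a, rfl⟩ ⟨b, hb⟩
    have : n₁ + 1 + b.1 = a.1 := congrArg Fin.val hb
    have := a.2
    omega
  let l {n m : ℕ} (e : Fin (n + 1) ↪ Fin (m + 1)) :
      pullback (terminal.from (ProjSpace n)) (terminal.from Y) ⟶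
        pullback (terminal.from (ProjSpace m)) (terminal.from Y) :=
    pullback.lift (pullback.fst _ _ ≫ ProjSpace.linear e) (pullback.snd _ _)
      (terminal.hom_ext _ _)
  have hlfst {n m : ℕ} (e : Fin (n + 1) ↪ Fin (m + 1)) :
      l e ≫ pullback.fst _ _ = pullback.fst _ _ ≫ ProjSpace.linear e := pullback.lift_fst _ _ _
  have hlsnd {n m : ℕ} (e : Fin (n + 1) ↪ Fin (m + 1)) :
      l e ≫ pullback.snd _ _ = pullback.snd _ _ := pullback.lift_snd _ _ _
  have hl {n m : ℕ} (e : Fin (n + 1) ↪ Fin (m + 1)) : IsClosedImmersion (l e) := by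
    refine (IsClosedImmersion.iff_isProper_and_mono _).mpr ⟨?_, ⟨fun u v huv ↦ ?_⟩⟩
    · have : IsProper (l e ≫ pullback.snd _ _) := by rw [hlsnd]; infer_instance
      exact .of_comp _ (pullback.snd _ _)
    · refine pullback.hom_ext ?_ ?_
      · rw [← cancel_mono (ProjSpace.linear e), Category.assoc, Category.assoc, ← hlfst,
          reassoc_of% huv]
      · rw [← hlsnd e, reassoc_of% huv]
  have hfst {Z : Scheme} {n m : ℕ} (e : Fin (n + 1) ↪ Fin (m + 1))
      (i : Z ⟶ pullback (terminal.from (ProjSpace n)) (terminal.from Y)) (z : Z) :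
      (i ≫ l e ≫ pullback.fst _ _) z ∈ Set.range (ProjSpace.linear e) := by
    refine ⟨(i ≫ pullback.fst _ _) z, ?_⟩
    rw [hlfst, ← Scheme.Hom.comp_apply, Category.assoc]
  have := isClosedImmersion_coprodDesc (i₁ ≫ l e₁) (i₂ ≫ l e₂) (by
    rw [Set.disjoint_left]
    rintro _ ⟨a, rfl⟩ ⟨b, hb⟩
    refine Set.disjoint_left.mp (ProjSpace.disjoint_range_linear e₁ e₂ he) (hfst e₁ i₁ a) ?_
    rw [← Category.assoc, Scheme.Hom.comp_apply, ← hb, ← Scheme.Hom.comp_apply, Category.assoc]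
    exact hfst e₂ i₂ b)
  refine ⟨_, coprod.desc (i₁ ≫ l e₁) (i₂ ≫ l e₂), this, ?_⟩
  ext
  · rw [coprod.inl_desc_assoc, coprod.inl_desc, Category.assoc, hlsnd]
  · rw [coprod.inr_desc_assoc, coprod.inr_desc, Category.assoc, hlsnd]

end IsProjectiveMorphism

namespace ProjSpace

open MvPolynomial

/-- The regular function `xₖ / xᵢ` on the standard affine open `D₊(xᵢ)`. -/
noncomputable def ratio {n : ℕ} (i k : Fin (n + 1)) : Γ(ProjSpace n, chart i) :=
  Proj.awayToSection (homogeneousSubmodule (Fin (n + 1)) ℤ) (X i)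
    (.mk _ (d := 1) (isHomogeneous_X ℤ i) 1 (X k) (isHomogeneous_X ℤ k))

/-- The homogeneous prime ideal of a point of projective space. -/
abbrev toProjectiveSpectrum {n : ℕ} (x : ProjSpace n) :
    ProjectiveSpectrum (homogeneousSubmodule (Fin (n + 1)) ℤ) := x

/-- Evaluation of a regular function in the local ring of the affine cone. -/
noncomputable def eval {n : ℕ} (V : (ProjSpace n).Opens) (x : V) :
    Γ(ProjSpace n, V) →+*
      Localization (toProjectiveSpectrum x.1).asHomogeneousIdeal.toIdeal.primeCompl where
  toFun s := (s.1 x).val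
  map_one' := HomogeneousLocalization.val_one
  map_zero' := HomogeneousLocalization.val_zero
  map_mul' _ _ := HomogeneousLocalization.val_mul _ _
  map_add' _ _ := HomogeneousLocalization.val_add _ _

lemma eval_ratio {n : ℕ} (i k : Fin (n + 1)) (x : chart i) :
    eval _ x (ratio i k) = Localization.mk (X k) ⟨X i, x.2⟩ := by
  have h := ProjectiveSpectrum.Proj.awayToSection_apply
    (homogeneousSubmodule (Fin (n + 1)) ℤ) (X i)
    (.mk _ (d := 1) (isHomogeneous_X ℤ i) 1 (X k) (isHomogeneous_X ℤ k)) x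
  refine Eq.trans ?_ (h.trans ?_)
  · rfl
  · erw [HomogeneousLocalization.Away.val_mk]
    rw [Localization.mk_eq_mk', Localization.mk_eq_mk', IsLocalization.map_mk']
    simp

lemma eval_injective {n : ℕ} {V : (ProjSpace n).Opens} {s t : Γ(ProjSpace n, V)}
    (h : ∀ x, eval V x s = eval V x t) : s = t := by
  apply Subtype.ext
  funext x
  exact HomogeneousLocalization.val_injective _ (h x)

lemma ratio_self {n : ℕ} (i : Fin (n + 1)) : ratio i i = 1 := by
  refine eval_injective fun x ↦ ?_
  rw [eval_ratio, map_one]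
  exact Localization.mk_self ⟨X i, x.2⟩

lemma ratio_mul_ratio {n : ℕ} (i j k : Fin (n + 1)) {V : (ProjSpace n).Opens}
    (hi : V ≤ chart i) (hj : V ≤ chart j) :
    (ProjSpace n).presheaf.map (homOfLE hi).op (ratio i k) *
      (ProjSpace n).presheaf.map (homOfLE hj).op (ratio j i) =
      (ProjSpace n).presheaf.map (homOfLE hj).op (ratio j k) := by
  refine eval_injective fun x ↦ ?_
  rw [map_mul]
  change eval (chart i) ⟨x, hi x.2⟩ (ratio i k) * eval (chart j) ⟨x, hj x.2⟩ (ratio j i) =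
    eval (chart j) ⟨x, hj x.2⟩ (ratio j k)
  rw [eval_ratio, eval_ratio, eval_ratio, Localization.mk_mul, Localization.mk_eq_mk_iff,
    Localization.r_iff_exists]
  exact ⟨1, by simp; ring⟩

lemma basicOpen_ratio_le {n : ℕ} (i k : Fin (n + 1)) :
    (ProjSpace n).basicOpen (ratio i k) ≤ chart k := by
  intro x hx hk
  have hle := (ProjSpace n).basicOpen_le (ratio i k)
  have hu := ((ProjSpace n).toRingedSpace.isUnit_res_basicOpen (ratio i k)).map (eval _ ⟨x, hx⟩)
  have : IsUnit (eval (chart i) ⟨x, hle hx⟩ (ratio i k)) := hu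
  rw [eval_ratio, Localization.mk_eq_mk', IsLocalization.AtPrime.isUnit_mk'_iff _
    (toProjectiveSpectrum x).asHomogeneousIdeal.toIdeal] at this
  exact this hk

end ProjSpace

lemma HomogeneousLocalization.Away.exists_lift {σ A R : Type} [CommRing A] [SetLike σ A]
    [AddSubgroupClass σ A] (𝒜 : ℕ → σ) [GradedRing 𝒜] {f : A} [CommRing R] (η : A →+* R)
    (hη : η f = 1) :
    ∃ ψ : HomogeneousLocalization.Away 𝒜 f →+* R, ∀ {d : ℕ} (hf : f ∈ 𝒜 d) n a ha,
      ψ (.mk 𝒜 hf n a ha) = η a := by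
  have hu : IsUnit (η f) := hη ▸ isUnit_one
  refine ⟨(IsLocalization.Away.lift (S := Localization.Away f) f hu).comp
    (algebraMap _ _), fun hf n a ha ↦ ?_⟩
  rw [RingHom.comp_apply, HomogeneousLocalization.algebraMap_apply,
    HomogeneousLocalization.Away.val_mk, Localization.mk_eq_mk', IsLocalization.Away.lift,
    IsLocalization.lift_mk'_spec]
  simp [hη]

lemma AlgebraicGeometry.Proj.exists_hom_of_away {σ A : Type} [CommRing A] [SetLike σ A]
    [AddSubgroupClass σ A] (𝒜 : ℕ → σ) [GradedRing 𝒜] {f : A} {m : ℕ} (hf : f ∈ 𝒜 m) (hm : 0 < m)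
    {U : Scheme} (ψ : CommRingCat.of (HomogeneousLocalization.Away 𝒜 f) ⟶ Γ(U, ⊤)) :
    ∃ (φ : U ⟶ Proj 𝒜) (h : ⊤ ≤ φ ⁻¹ᵁ Proj.basicOpen 𝒜 f),
      Proj.awayToSection 𝒜 f ≫ φ.appLE (Proj.basicOpen 𝒜 f) ⊤ h = ψ := by
  let e := Proj.basicOpenIsoSpec 𝒜 f hf hm
  let h : U ⟶ (Proj.basicOpen 𝒜 f).toScheme := U.toSpecΓ ≫ Spec.map ψ ≫ e.inv
  have h1 : h ≫ Proj.basicOpenToSpec 𝒜 f = U.toSpecΓ ≫ Spec.map ψ := by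
    rw [← Proj.basicOpenIsoSpec_hom 𝒜 f hf hm]
    simp [h, e]
  have hh : Proj.awayToSection 𝒜 f ≫ (Proj.basicOpen 𝒜 f).topIso.inv ≫ h.appTop = ψ := by
    have h2 : (h ≫ Proj.basicOpenToSpec 𝒜 f).appTop = (U.toSpecΓ ≫ Spec.map ψ).appTop := by rw [h1]
    rw [Scheme.Hom.comp_appTop, Scheme.Hom.appTop, Proj.basicOpenToSpec_app_top, Category.assoc,
      Category.assoc] at h2
    refine (cancel_epi (Scheme.ΓSpecIso _).hom).mp (h2.trans ?_)
    simp
  have hle : ⊤ ≤ (h ≫ (Proj.basicOpen 𝒜 f).ι) ⁻¹ᵁ (Proj.basicOpen 𝒜 f) := by simp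
  refine ⟨h ≫ (Proj.basicOpen 𝒜 f).ι, hle, ?_⟩
  have ha : h.appTop = h.appLE ⊤ ⊤ le_top := Scheme.Hom.app_eq_appLE _
  have hi : (Proj.basicOpen 𝒜 f).ι.app (Proj.basicOpen 𝒜 f) ≫
      (Proj.basicOpen 𝒜 f).toScheme.presheaf.map
        (homOfLE (Scheme.Opens.ι_preimage_self (Proj.basicOpen 𝒜 f)).ge).op =
      (Proj.basicOpen 𝒜 f).topIso.inv :=
    ((Proj 𝒜).presheaf.map_comp _ _).symm
  rw [← hh, Scheme.Hom.comp_appLE, ha, ← hi, Category.assoc]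
  exact congrArg (fun t ↦ Proj.awayToSection 𝒜 f ≫
    (Proj.basicOpen 𝒜 f).ι.app (Proj.basicOpen 𝒜 f) ≫ t)
    (h.map_appLE (U := ⊤) (V := ⊤) le_top
      (homOfLE (Scheme.Opens.ι_preimage_self (Proj.basicOpen 𝒜 f)).ge).op).symm

namespace ProjSpace

open MvPolynomial

lemma exists_hom {n : ℕ} {U : Scheme} (g : Fin (n + 1) → Γ(U, ⊤)) (i : Fin (n + 1))
    (hi : g i = 1) :
    ∃ (φ : U ⟶ ProjSpace n) (h : ⊤ ≤ φ ⁻¹ᵁ chart i),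
      ∀ k, φ.appLE (chart i) ⊤ h (ratio i k) = g k := by
  have hX (k : Fin (n + 1)) : X k ∈ homogeneousSubmodule (Fin (n + 1)) ℤ 1 := isHomogeneous_X ℤ k
  obtain ⟨ψ, hψ⟩ := HomogeneousLocalization.Away.exists_lift
    (homogeneousSubmodule (Fin (n + 1)) ℤ) (f := X i) (eval₂Hom (Int.castRingHom Γ(U, ⊤)) g)
    (by simp [hi])
  obtain ⟨φ, h, hφ⟩ := Proj.exists_hom_of_away _ (hX i) one_pos (CommRingCat.ofHom ψ)
  refine ⟨φ, h, fun k ↦ (ConcreteCategory.congr_hom hφ _).trans ((hψ (hX i) _ _ (hX k)).trans ?_)⟩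
  simp

end ProjSpace

namespace AlgebraicGeometry

lemma IsAffineOpen.toSpecΓ_SpecMap_appLE_fromSpec {X T : Scheme} {U : X.Opens}
    (hU : IsAffineOpen U) (s : T ⟶ X) (V : T.Opens) (h : V ≤ s ⁻¹ᵁ U) :
    V.toSpecΓ ≫ Spec.map (s.appLE U V h) ≫ hU.fromSpec = V.ι ≫ s := by
  rw [Scheme.Opens.toSpecΓ_SpecMap_appLE_assoc, hU.toSpecΓ_fromSpec, Scheme.Hom.resLE_comp_ι]

lemma IsAffineOpen.hom_ext {X B T : Scheme} (sX : X ⟶ B) {U : X.Opens} (hU : IsAffineOpen U)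
    {S : Set Γ(X, U)}
    (hS : Subring.closure (Set.range (sX.appLE ⊤ U le_top) ∪ S) = ⊤)
    {s t : T ⟶ X} (hst : s ≫ sX = t ≫ sX) (hs : ⊤ ≤ s ⁻¹ᵁ U) (ht : ⊤ ≤ t ⁻¹ᵁ U)
    (h : ∀ f ∈ S, s.appLE U ⊤ hs f = t.appLE U ⊤ ht f) : s = t := by
  have key : s.appLE U ⊤ hs = t.appLE U ⊤ ht := by
    refine CommRingCat.hom_ext (RingHom.eq_of_eqOn_set_top ?_)
    rw [← hS]
    refine RingHom.eqOn_set_closure ?_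
    rintro _ (⟨r, rfl⟩ | hf)
    · have h1 := s.appLE_comp_appLE sX ⊤ U ⊤ le_top hs
      have h2 := t.appLE_comp_appLE sX ⊤ U ⊤ le_top ht
      have h3 : (s ≫ sX).appLE ⊤ ⊤ le_top = (t ≫ sX).appLE ⊤ ⊤ le_top := by rw [hst]
      exact ConcreteCategory.congr_hom (h1.trans (h3.trans h2.symm)) r
    · exact h _ hf
  rw [← cancel_epi T.topIso.hom, T.topIso_hom, ← hU.toSpecΓ_SpecMap_appLE_fromSpec s ⊤ hs, key,
    hU.toSpecΓ_SpecMap_appLE_fromSpec]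

lemma IsAffineOpen.le_preimage_of_forall_mem_range {X B U₀ Z : Scheme} [X.IsSeparated] [IsReduced Z]
    (sX : X ⟶ B) {U : X.Opens} (hU : IsAffineOpen U) {S : Set Γ(X, U)}
    (hS : Subring.closure (Set.range (sX.appLE ⊤ U le_top) ∪ S) = ⊤)
    (j : U₀ ⟶ Z) [IsDominant j] (a : Z ⟶ X) (T : Z.Opens) (hj : Function.Injective (j.app T))
    (hT : j ⁻¹ᵁ T ≤ (j ≫ a) ⁻¹ᵁ U)
    (h : ∀ f ∈ S, ∃ u, j.app T u = (j ≫ a).appLE U (j ⁻¹ᵁ T) hT f) : T ≤ a ⁻¹ᵁ U := by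
  have hQ : (j.app T).hom.range.comap ((j ≫ a).appLE U (j ⁻¹ᵁ T) hT).hom = ⊤ := by
    rw [← top_le_iff, ← hS, Subring.closure_le]
    rintro _ (⟨r, rfl⟩ | hf)
    · refine ⟨(a ≫ sX).appLE ⊤ T le_top r, ?_⟩
      have h1 := (j ≫ a).appLE_comp_appLE sX ⊤ U (j ⁻¹ᵁ T) le_top hT
      have h2 := j.appLE_comp_appLE (a ≫ sX) ⊤ T (j ⁻¹ᵁ T) le_top le_rfl
      have h3 : (j ≫ a ≫ sX).appLE ⊤ (j ⁻¹ᵁ T) le_top =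
        ((j ≫ a) ≫ sX).appLE ⊤ (j ⁻¹ᵁ T) le_top := by simp only [Category.assoc]
      rw [← Scheme.Hom.app_eq_appLE] at h2
      exact ConcreteCategory.congr_hom (h2.trans (h3.trans h1.symm)) r
    · exact h _ hf
  let e := RingEquiv.ofBijective (j.app T).hom.rangeRestrict
    ⟨fun x y hxy ↦ hj (congrArg Subtype.val hxy), (j.app T).hom.rangeRestrict_surjective⟩
  let c : Γ(X, U) ⟶ Γ(Z, T) := CommRingCat.ofHom (e.symm.toRingHom.comp
    (((j ≫ a).appLE U (j ⁻¹ᵁ T) hT).hom.codRestrict (j.app T).hom.range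
      fun x ↦ hQ.ge (Subring.mem_top x)))
  have hc : c ≫ j.app T = (j ≫ a).appLE U (j ⁻¹ᵁ T) hT := by
    ext x
    exact congrArg Subtype.val (e.apply_symm_apply _)
  have hd : IsDominant (j ∣_ T) :=
    IsZariskiLocalAtTarget.restrict (P := @IsDominant) inferInstance T
  have hcT : T.toSpecΓ ≫ Spec.map c ≫ hU.fromSpec = T.ι ≫ a := by
    refine ext_of_isDominant (j ∣_ T) ?_
    rw [← Scheme.Opens.toSpecΓ_naturality_assoc, ← Spec.map_comp_assoc, hc,
      hU.toSpecΓ_SpecMap_appLE_fromSpec, morphismRestrict_ι_assoc]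
  intro z hz
  have : (T.ι ≫ a) ⟨z, hz⟩ ∈ U := by
    rw [← hcT, ← SetLike.mem_coe, ← hU.range_fromSpec]
    exact ⟨_, rfl⟩
  exact this

end AlgebraicGeometry

namespace ProjSpace

lemma app_ratio_mul {n : ℕ} {E : Scheme} (φ : E ⟶ ProjSpace n) {g : Fin (n + 1) → Γ(E, ⊤)}
    {i : Fin (n + 1)} (h : ⊤ ≤ φ ⁻¹ᵁ chart i)
    (hφ : ∀ k, φ.appLE (chart i) ⊤ h (ratio i k) = g k) (j k : Fin (n + 1)) :
    φ.app (chart j) (ratio j k) * E.presheaf.map (homOfLE le_top).op (g j) =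
      E.presheaf.map (homOfLE le_top).op (g k) := by
  have hV : φ ⁻¹ᵁ chart j ≤ φ ⁻¹ᵁ (chart i ⊓ chart j) := fun x hx ↦ ⟨h trivial, hx⟩
  have hl (k) : φ.appLE (chart i ⊓ chart j) _ hV
      ((ProjSpace n).presheaf.map (homOfLE inf_le_left).op (ratio i k)) =
      E.presheaf.map (homOfLE le_top).op (g k) := by
    rw [← hφ k]
    have h1 := φ.map_appLE (U' := chart i) hV (homOfLE inf_le_left).op
    have h2 := φ.appLE_map (V' := φ ⁻¹ᵁ chart j) h (homOfLE le_top).op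
    exact ConcreteCategory.congr_hom (h1.trans h2.symm) (ratio i k)
  have hr (k) : φ.appLE (chart i ⊓ chart j) _ hV
      ((ProjSpace n).presheaf.map (homOfLE inf_le_right).op (ratio j k)) =
      φ.app (chart j) (ratio j k) := by
    have h1 := φ.map_appLE (U' := chart j) hV (homOfLE inf_le_right).op
    exact ConcreteCategory.congr_hom (h1.trans (Scheme.Hom.app_eq_appLE _).symm) (ratio j k)
  have key (k) : E.presheaf.map (homOfLE le_top).op (g k) * φ.app (chart j) (ratio j i) =
      φ.app (chart j) (ratio j k) := by
    rw [← hl, ← hr, ← hr, ← map_mul, ratio_mul_ratio i j k inf_le_left inf_le_right]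
  have hj := key j
  rw [ratio_self, map_one] at hj
  rw [← key k, mul_assoc, mul_comm (φ.app (chart j) (ratio j i)), hj, mul_one]

lemma exists_hom_app_ratio {E : Scheme} {ι : Type} [Finite ι] (S : ι → Finset Γ(E, ⊤))
    (hS : ∀ i, 1 ∈ S i) :
    ∃ (n : ℕ) (φ : E ⟶ ProjSpace n) (J : ι → Fin (n + 1) → Fin (n + 1)),
      (∀ i j, ∃ c ∈ S i, E.presheaf.map (homOfLE le_top).op c *
        φ.app (chart j) (ratio j (J i j)) = 1) ∧
      ∀ i j, ∀ f ∈ S i, ∃ k, φ.app (chart (J i j)) (ratio (J i j) k) =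
        E.presheaf.map (homOfLE le_top).op f := by
  classical
  have := Fintype.ofFinite ι
  let one : ∀ i, S i := fun i ↦ ⟨1, hS i⟩
  obtain ⟨n, hn⟩ := Nat.exists_eq_succ_of_ne_zero
    (Fintype.card_pos_iff.mpr ⟨one⟩ : 0 < Fintype.card (∀ i, S i)).ne'
  let e : Fin (n + 1) ≃ ∀ i, S i := (Fintype.equivFinOfCardEq hn).symm
  let g (j : Fin (n + 1)) : Γ(E, ⊤) := ∏ i, (e j i).1
  have hg (i j) (f : S i) : g (e.symm (Function.update (e j) i f)) =
      f.1 * g (e.symm (Function.update (e j) i (one i))) := by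
    simp only [g, Equiv.apply_symm_apply]
    rw [← Finset.mul_prod_erase _ _ (Finset.mem_univ i),
      ← Finset.mul_prod_erase (a := i) Finset.univ
        (fun x ↦ (Function.update (e j) i (one i) x).1) (Finset.mem_univ i)]
    simp only [Function.update_self, one, one_mul]
    congr 1
    refine Finset.prod_congr rfl fun x hx ↦ ?_
    rw [Function.update_of_ne (Finset.ne_of_mem_erase hx),
      Function.update_of_ne (Finset.ne_of_mem_erase hx)]
  have h1 : g (e.symm one) = 1 := by simp [g, one]
  obtain ⟨φ, h, hφ⟩ := exists_hom g (e.symm one) h1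
  have hm := app_ratio_mul φ h hφ
  have hu (j) : IsUnit (E.presheaf.map (homOfLE (le_top : φ ⁻¹ᵁ chart j ≤ ⊤)).op (g j)) :=
    .of_mul_eq_one_right _ ((hm j (e.symm one)).trans (by rw [h1, map_one]))
  refine ⟨n, φ, fun i j ↦ e.symm (Function.update (e j) i (one i)), fun i j ↦
    ⟨_, (e j i).2, (hu j).mul_right_cancel ?_⟩, fun i j f hf ↦
    ⟨e.symm (Function.update (e j) i ⟨f, hf⟩), (hu _).mul_right_cancel ?_⟩⟩
  · have h2 := hg i j (e j i)
    rw [Function.update_eq_self, Equiv.symm_apply_apply] at h2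
    rw [mul_assoc, hm, ← map_mul, ← h2, one_mul]
  · rw [hm, ← map_mul, hg i j ⟨f, hf⟩]

variable {X Y Z E B P : Scheme} {n : ℕ} {U : X.Opens} {a : Z ⟶ X} {b : Z ⟶ P}
  {π : P ⟶ ProjSpace n} {j : E ⟶ Z} {e : E ⟶ X} {φ : E ⟶ ProjSpace n}

lemma mem_chart_of_app_ratio_mul_eq_one (he : j ≫ a = e) (hφ : j ≫ b ≫ π = φ)
    (hj : ∀ W : Z.Opens, Function.Injective (j.app W)) {l m : Fin (n + 1)}
    (hl : φ ⁻¹ᵁ chart l ≤ e ⁻¹ᵁ U) {c : Γ(X, U)}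
    (hc : e.appLE U (φ ⁻¹ᵁ chart l) hl c * φ.app (chart l) (ratio l m) = 1)
    {z : Z} (hz : a z ∈ U) (hz' : (b ≫ π) z ∈ chart l) : (b ≫ π) z ∈ chart m := by
  subst he hφ
  let W : Z.Opens := a ⁻¹ᵁ U ⊓ (b ≫ π) ⁻¹ᵁ chart l
  have hW : a.appLE U W inf_le_left c * (b ≫ π).appLE (chart l) W inf_le_right (ratio l m) = 1 := by
    refine hj W ?_
    rw [map_mul, map_one]
    have h1 : a.appLE U W inf_le_left ≫ j.app W = (j ≫ a).appLE U _ hl ≫ E.presheaf.map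
        (homOfLE (show j ⁻¹ᵁ W ≤ (j ≫ b ≫ π) ⁻¹ᵁ chart l from fun x hx ↦ hx.2)).op := by
      rw [Scheme.Hom.appLE_map, Scheme.Hom.app_eq_appLE, Scheme.Hom.appLE_comp_appLE]
    have h2 : (b ≫ π).appLE (chart l) W inf_le_right ≫ j.app W =
        (j ≫ b ≫ π).app (chart l) ≫ E.presheaf.map
        (homOfLE (show j ⁻¹ᵁ W ≤ (j ≫ b ≫ π) ⁻¹ᵁ chart l from fun x hx ↦ hx.2)).op := by
      rw [Scheme.Hom.app_eq_appLE, Scheme.Hom.app_eq_appLE, Scheme.Hom.appLE_map,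
        Scheme.Hom.appLE_comp_appLE]
    have h3 := congrArg (E.presheaf.map
      (homOfLE (show j ⁻¹ᵁ W ≤ (j ≫ b ≫ π) ⁻¹ᵁ chart l from fun x hx ↦ hx.2)).op) hc
    rw [map_mul, map_one] at h3
    exact (congrArg₂ (· * ·) (ConcreteCategory.congr_hom h1 c)
      (ConcreteCategory.congr_hom h2 (ratio l m))).trans h3
  have hu := IsUnit.of_mul_eq_one_right _ hW
  have hzW : z ∈ W := ⟨hz, hz'⟩
  rw [← Scheme.basicOpen_of_isUnit _ hu, Scheme.basicOpen_appLE] at hzW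
  exact basicOpen_ratio_le l m hzW.2

lemma mono_ι_comp [X.IsSeparated] [IsReduced Z] [IsDominant j] (sX : X ⟶ B) (p : X ⟶ Y)
    (sY : Y ⟶ B) (hp : p ≫ sY = sX) (ϖ : P ⟶ Y) (hϖ : a ≫ p = b ≫ ϖ)
    (hab : ∀ {T : Scheme} (s t : T ⟶ Z), s ≫ a = t ≫ a → s ≫ b = t ≫ b → s = t)
    (he : j ≫ a = e) (hφ : j ≫ b ≫ π = φ) (hj : ∀ W : Z.Opens, Function.Injective (j.app W))
    (hU : IsAffineOpen U) {S : Set Γ(X, U)}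
    (hS : Subring.closure (Set.range (sX.appLE ⊤ U le_top) ∪ S) = ⊤) (m : Fin (n + 1))
    (hm : φ ⁻¹ᵁ chart m ≤ e ⁻¹ᵁ U)
    (h : ∀ f ∈ S, ∃ k, φ.app (chart m) (ratio m k) = e.appLE U (φ ⁻¹ᵁ chart m) hm f) :
    Mono ((b ⁻¹ᵁ π ⁻¹ᵁ chart m).ι ≫ b) := by
  subst he hφ
  set T : Z.Opens := b ⁻¹ᵁ π ⁻¹ᵁ chart m
  have happ (k) : j.app T ((b ≫ π).app (chart m) (ratio m k)) =
      (j ≫ b ≫ π).app (chart m) (ratio m k) :=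
    (ConcreteCategory.congr_hom (Scheme.Hom.comp_app j (b ≫ π) (chart m)) (ratio m k)).symm
  have hle : T ≤ a ⁻¹ᵁ U := hU.le_preimage_of_forall_mem_range sX hS j a T (hj T) hm fun f hf ↦ by
    obtain ⟨k, hk⟩ := h f hf
    exact ⟨_, (happ k).trans hk⟩
  have hle' (f) (hf : f ∈ S) : ∃ k, a.appLE U T hle f = (b ≫ π).app (chart m) (ratio m k) := by
    obtain ⟨k, hk⟩ := h f hf
    refine ⟨k, hj T (((happ k).trans hk).trans ?_).symm⟩
    rw [Scheme.Hom.app_eq_appLE]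
    exact (ConcreteCategory.congr_hom (j.appLE_comp_appLE a U T _ hle le_rfl) f).symm
  refine ⟨fun {R} h₁ h₂ h12 ↦ ?_⟩
  have hR (r : R ⟶ T.toScheme) : ⊤ ≤ (r ≫ T.ι) ⁻¹ᵁ T := fun x _ ↦ (r x).2
  have hb : (h₁ ≫ T.ι) ≫ b = (h₂ ≫ T.ι) ≫ b := by simpa only [Category.assoc] using h12
  have ha : (h₁ ≫ T.ι) ≫ a = (h₂ ≫ T.ι) ≫ a := by
    refine hU.hom_ext sX hS ?_ (fun x hx ↦ hle (hR h₁ hx)) (fun x hx ↦ hle (hR h₂ hx))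
      fun f hf ↦ ?_
    · have hbr := (Category.assoc _ _ _).symm.trans
        ((congrArg (· ≫ ϖ ≫ sY) hb).trans (Category.assoc _ _ _))
      simpa only [← hp, Category.assoc, reassoc_of% hϖ] using hbr
    · obtain ⟨k, hk⟩ := hle' f hf
      have key (r : R ⟶ T.toScheme) : ((r ≫ T.ι) ≫ a).appLE U ⊤ (fun x hx ↦ hle (hR r hx)) f =
          (((r ≫ T.ι) ≫ b) ≫ π).appLE (chart m) ⊤ (hR r) (ratio m k) := by
        have h1 := (r ≫ T.ι).appLE_comp_appLE a U T ⊤ hle (hR r)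
        have h2 := (congrArg (· ≫ (r ≫ T.ι).appLE T ⊤ (hR r)) (b ≫ π).app_eq_appLE).trans
          ((r ≫ T.ι).appLE_comp_appLE (b ≫ π) (chart m) T ⊤ le_rfl (hR r))
        refine (ConcreteCategory.congr_hom h1 f).symm.trans ?_
        refine (congrArg ((r ≫ T.ι).appLE T ⊤ (hR r)) hk).trans ?_
        refine (ConcreteCategory.congr_hom h2 (ratio m k)).trans ?_
        simp only [Category.assoc]
      rw [key, key]
      simp only [hb]
  exact (cancel_mono T.ι).mp (hab _ _ ha hb)

lemma mono_of_app_ratio [X.IsSeparated] [IsReduced Z] [IsDominant j] (sX : X ⟶ B) (p : X ⟶ Y)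
    (sY : Y ⟶ B) (hp : p ≫ sY = sX) (ϖ : P ⟶ Y) (hϖ : a ≫ p = b ≫ ϖ)
    (hab : ∀ {T : Scheme} (s t : T ⟶ Z), s ≫ a = t ≫ a → s ≫ b = t ≫ b → s = t)
    (he : j ≫ a = e) (hφ : j ≫ b ≫ π = φ) (hj : ∀ W : Z.Opens, Function.Injective (j.app W))
    {ι : Type} {U : ι → X.Opens} (hU : ∀ i, IsAffineOpen (U i)) (hU' : ⨆ i, U i = ⊤)
    {S : ∀ i, Set Γ(X, U i)}
    (hS : ∀ i, Subring.closure (Set.range (sX.appLE ⊤ (U i) le_top) ∪ S i) = ⊤)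
    (J : ι → Fin (n + 1) → Fin (n + 1)) (heU : ∀ i, ⊤ ≤ e ⁻¹ᵁ U i)
    (h₁ : ∀ i l, ∃ c, e.appLE (U i) (φ ⁻¹ᵁ chart l) (le_top.trans (heU i)) c *
      φ.app (chart l) (ratio l (J i l)) = 1)
    (h₂ : ∀ i l, ∀ f ∈ S i, ∃ k, φ.app (chart (J i l)) (ratio (J i l) k) =
      e.appLE (U i) (φ ⁻¹ᵁ chart (J i l)) (le_top.trans (heU i)) f) :
    Mono b := by
  refine mono_of_iSup_preimage_eq_top b (fun k : ι × Fin (n + 1) ↦ π ⁻¹ᵁ chart (J k.1 k.2)) ?_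
    fun k ↦ mono_ι_comp sX p sY hp ϖ hϖ hab he hφ hj (hU k.1) (hS k.1) _ _ (h₂ k.1 k.2)
  refine top_le_iff.mp fun z _ ↦ ?_
  obtain ⟨i, hi⟩ := TopologicalSpace.Opens.mem_iSup.mp (hU'.ge (trivial : a z ∈ ⊤))
  obtain ⟨l, hl⟩ := TopologicalSpace.Opens.mem_iSup.mp
    ((iSup_chart n).ge (trivial : (b ≫ π) z ∈ ⊤))
  obtain ⟨c, hc⟩ := h₁ i l
  exact TopologicalSpace.Opens.mem_iSup.mpr
    ⟨(i, l), mem_chart_of_app_ratio_mul_eq_one he hφ hj _ hc hi hl⟩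

end ProjSpace

lemma AlgebraicGeometry.IsAffineOpen.exists_finset_closure_eq_top {X B : Scheme} [IsAffine B]
    (sX : X ⟶ B) [LocallyOfFiniteType sX] {U : X.Opens} (hU : IsAffineOpen U) :
    ∃ S : Finset Γ(X, U), 1 ∈ S ∧
      Subring.closure (Set.range (sX.appLE ⊤ U le_top) ∪ (S : Set Γ(X, U))) = ⊤ := by
  classical
  have hft : (sX.appLE ⊤ U le_top).hom.FiniteType :=
    sX.finiteType_appLE (isAffineOpen_top B) hU le_top
  algebraize [(sX.appLE ⊤ U le_top).hom]
  obtain ⟨S, hS⟩ := hft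
  refine ⟨insert 1 S, Finset.mem_insert_self _ _, top_le_iff.mp ?_⟩
  have h := congrArg Subalgebra.toSubring hS
  rw [Algebra.adjoin_eq_ring_closure, Algebra.top_toSubring] at h
  rw [← h]
  exact Subring.closure_mono (Set.union_subset_union_right _ (by simp))

lemma AlgebraicGeometry.exists_finite_affine_cover (X : Scheme.{0}) [CompactSpace X] :
    ∃ (ι : Type) (_ : Finite ι) (U : ι → X.Opens), (∀ i, IsAffineOpen (U i)) ∧
      (∀ i, (U i : Set X).Nonempty) ∧ ⨆ i, U i = ⊤ := by
  choose U hU hxU _ using fun x : X ↦ exists_isAffineOpen_mem_and_subset (U := ⊤) (x := x) trivial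
  obtain ⟨t, ht⟩ := CompactSpace.elim_nhds_subcover (fun x ↦ (U x : Set X))
    fun x ↦ (U x).isOpen.mem_nhds (hxU x)
  refine ⟨t, inferInstance, fun i ↦ U i, fun i ↦ hU i, fun i ↦ ⟨i, hxU i⟩,
    TopologicalSpace.Opens.ext ?_⟩
  rw [TopologicalSpace.Opens.coe_iSup, TopologicalSpace.Opens.coe_top, ← Set.top_eq_univ, ← ht,
    Set.iUnion_subtype]

/-- Chow's lemma for a proper morphism from an integral scheme. -/
lemma exists_isProjectiveMorphism_of_isIntegral {X Y B : Scheme} [IsAffine B] [IsIntegral X]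
    [X.IsSeparated] [TopologicalSpace.NoetherianSpace X] (sX : X ⟶ B) [LocallyOfFiniteType sX]
    (sY : Y ⟶ B) (p : X ⟶ Y) [IsProper p] (hp : p ≫ sY = sX) :
    ∃ (Z : Scheme) (q : Z ⟶ Y) (f : Z ⟶ X), IsProjectiveMorphism q ∧ f ≫ p = q ∧
      ∃ (U₀ : X.Opens) (_ : Nonempty U₀) (s : U₀.toScheme ⟶ Z), s ≫ f = U₀.ι := by
  classical
  obtain ⟨ι, _, U, hU, hne, htop⟩ := exists_finite_affine_cover X
  choose S hS₁ hS using fun i ↦ (hU i).exists_finset_closure_eq_top sX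
  let U₀ : X.Opens := ⟨⋂ i, U i, isOpen_iInter_of_finite fun i ↦ (U i).isOpen⟩
  have h₀ (i) : ⊤ ≤ U₀.ι ⁻¹ᵁ U i := fun x _ ↦ Set.mem_iInter.mp x.2 i
  have hU₀ : Nonempty U₀ := ⟨genericPoint X, Set.mem_iInter.mpr fun i ↦
    ((genericPoint_spec X).mem_open_set_iff (U i).isOpen).mpr (by simpa using hne i)⟩
  obtain ⟨n, φ, J, h₁, h₂⟩ := ProjSpace.exists_hom_app_ratio (E := U₀.toScheme)
    (fun i ↦ (S i).image (U₀.ι.appLE (U i) ⊤ (h₀ i)))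
    fun i ↦ Finset.mem_image.mpr ⟨1, hS₁ i, map_one _⟩
  have hres (i) (V : U₀.toScheme.Opens) (f) : U₀.toScheme.presheaf.map (homOfLE le_top).op
      (U₀.ι.appLE (U i) ⊤ (h₀ i) f) = U₀.ι.appLE (U i) V (le_top.trans (h₀ i)) f :=
    ConcreteCategory.congr_hom (U₀.ι.appLE_map (h₀ i) (homOfLE (le_top : V ≤ ⊤)).op) f
  let P := pullback (terminal.from (ProjSpace n)) (terminal.from Y)
  let β : U₀.toScheme ⟶ P := pullback.lift φ (U₀.ι ≫ p) (terminal.hom_ext _ _)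
  let s₀ : U₀.toScheme ⟶ pullback p (pullback.snd _ _ : P ⟶ Y) :=
    pullback.lift U₀.ι β (pullback.lift_snd _ _ _).symm
  have : TopologicalSpace.NoetherianSpace U₀.toScheme :=
    inferInstanceAs (TopologicalSpace.NoetherianSpace (U₀ : Set X))
  let a : s₀.image ⟶ X := s₀.imageι ≫ pullback.fst _ _
  let b : s₀.image ⟶ P := s₀.imageι ≫ pullback.snd _ _
  have ha : s₀.toImage ≫ a = U₀.ι := by
    rw [Scheme.Hom.toImage_imageι_assoc]
    exact pullback.lift_fst _ _ _
  have hb : s₀.toImage ≫ b ≫ pullback.fst _ _ = φ := by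
    rw [← Category.assoc, Scheme.Hom.toImage_imageι_assoc]
    exact (congrArg (· ≫ pullback.fst _ _) (pullback.lift_snd _ _ _)).trans
      (pullback.lift_fst _ _ _)
  have hab : a ≫ p = b ≫ pullback.snd _ _ := by
    simp only [a, b, Category.assoc, pullback.condition]
  have : IsIntegral s₀.image := s₀.isIntegral_image
  have : IsSchemeTheoreticallyDominant s₀.toImage := .of_isDominant _
  have : IsProper b := inferInstance
  have : Mono b := by
    refine ProjSpace.mono_of_app_ratio sX p sY hp (pullback.snd _ _) hab ?_ ha hb
      s₀.toImage.app_injective hU htop hS J h₀ (fun i l ↦ ?_) fun i l f hf ↦ ?_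
    · intro T s t hsa hsb
      refine (cancel_mono s₀.imageι).mp (pullback.hom_ext ?_ ?_)
      · simpa only [Category.assoc] using hsa
      · simpa only [Category.assoc] using hsb
    · obtain ⟨c, hc, hc'⟩ := h₁ i l
      obtain ⟨c, -, rfl⟩ := Finset.mem_image.mp hc
      exact ⟨c, by rwa [hres] at hc'⟩
    · obtain ⟨k, hk⟩ := h₂ i l _ (Finset.mem_image_of_mem _ hf)
      exact ⟨k, by rwa [hres] at hk⟩
  exact ⟨s₀.image, a ≫ p, a, ⟨n, b, (IsClosedImmersion.iff_isProper_and_mono _).mpr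
    ⟨inferInstance, inferInstance⟩, hab.symm⟩, rfl, U₀, hU₀, s₀.toImage, ha⟩

instance AlgebraicGeometry.isClosedImmersion_coprodInl (X Y : Scheme) :
    IsClosedImmersion (coprod.inl : X ⟶ X ⨿ Y) :=
  .of_isPreimmersion _ <| by
    rw [(isCompl_range_inl_inr X Y).eq_compl]
    exact (coprod.inr : Y ⟶ X ⨿ Y).isOpenEmbedding.isOpen_range.isClosed_compl

instance AlgebraicGeometry.isClosedImmersion_coprodInr (X Y : Scheme) :
    IsClosedImmersion (coprod.inr : Y ⟶ X ⨿ Y) :=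
  .of_isPreimmersion _ <| by
    rw [(isCompl_range_inl_inr X Y).symm.eq_compl]
    exact (coprod.inl : X ⟶ X ⨿ Y).isOpenEmbedding.isOpen_range.isClosed_compl

lemma AlgebraicGeometry.exists_isIntegral_range_eq {X : Scheme} {C : Set X} (hC : IsClosed C)
    (hC' : IsIrreducible C) :
    ∃ (W : Scheme) (ι : W ⟶ X), IsClosedImmersion ι ∧ IsIntegral W ∧ Set.range ι = C := by
  let I := Scheme.IdealSheafData.vanishingIdeal (X := X) ⟨C, hC⟩
  have hr : Set.range I.subschemeι = C := by
    rw [Scheme.IdealSheafData.range_subschemeι, Scheme.IdealSheafData.coe_support_vanishingIdeal]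
    rfl
  have : IsReduced I.subscheme := I.isReduced_subscheme fun U ↦
    PrimeSpectrum.isRadical_vanishingIdeal _
  have : IrreducibleSpace (Set.range I.subschemeι) :=
    isIrreducible_iff_irreducibleSpace.mp (hr ▸ hC')
  have : IrreducibleSpace I.subscheme :=
    I.subschemeι.isClosedEmbedding.isEmbedding.toHomeomorph.irreducibleSpace_iff.mpr this
  exact ⟨_, I.subschemeι, inferInstance, isIntegral_of_irreducibleSpace_of_isReduced _, hr⟩

/-- The subscheme `ι : W ⟶ X` is the birational image of an integral closed subscheme of `Z`. -/
def HasBirationalLift {Z X W : Scheme} (f : Z ⟶ X) (ι : W ⟶ X) : Prop :=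
  ∃ (W' : Scheme) (ι' : W' ⟶ Z) (g : W' ⟶ W),
    IsClosedImmersion ι' ∧ IsIntegral W' ∧ ι' ≫ f = g ≫ ι ∧ IsBirationalOnto g

namespace HasBirationalLift

lemma of_comp_eq {Z Z' X W : Scheme} {f : Z ⟶ X} {f' : Z' ⟶ X} {ι : W ⟶ X}
    (h : HasBirationalLift f ι) (c : Z ⟶ Z') [IsClosedImmersion c] (hc : c ≫ f' = f) :
    HasBirationalLift f' ι := by
  obtain ⟨W', ι', g, _, hW', hg, hb⟩ := h
  exact ⟨W', ι' ≫ c, g, inferInstance, hW', by rw [Category.assoc, hc, hg], hb⟩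

lemma comp_right {Z X X' W : Scheme} {f : Z ⟶ X} {ι : W ⟶ X} (h : HasBirationalLift f ι)
    (c : X ⟶ X') : HasBirationalLift (f ≫ c) (ι ≫ c) := by
  obtain ⟨W', ι', g, hι', hW', hg, hb⟩ := h
  exact ⟨W', ι', g, hι', hW', by rw [reassoc_of% hg], hb⟩

lemma of_section {Z X W : Scheme} [TopologicalSpace.NoetherianSpace X] (f : Z ⟶ X) [IsSeparated f]
    (U : X.Opens) (s : U.toScheme ⟶ Z) (hs : s ≫ f = U.ι) (κ : W ⟶ X) [IsClosedImmersion κ]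
    [IsIntegral W] [Nonempty (κ ⁻¹ᵁ U)] : HasBirationalLift f κ := by
  have : TopologicalSpace.NoetherianSpace W :=
    κ.isClosedEmbedding.isEmbedding.isInducing.noetherianSpace
  have : TopologicalSpace.NoetherianSpace (κ ⁻¹ᵁ U).toScheme :=
    inferInstanceAs (TopologicalSpace.NoetherianSpace ((κ ⁻¹ᵁ U : W.Opens) : Set W))
  let t : (κ ⁻¹ᵁ U).toScheme ⟶ pullback κ f := pullback.lift (κ ⁻¹ᵁ U).ι (κ ∣_ U ≫ s)
    (by rw [Category.assoc, hs, morphismRestrict_ι])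
  exact ⟨t.image, t.imageι ≫ pullback.snd _ _, t.imageι ≫ pullback.fst _ _, inferInstance,
    t.isIntegral_image, by simp only [Category.assoc, pullback.condition],
    isBirationalOnto_image _ _ t (pullback.lift_fst _ _ _)⟩

end HasBirationalLift

lemma exists_isProjectiveMorphism_hasBirationalLift {X Y B : Scheme} [IsAffine B] [X.IsSeparated]
    [TopologicalSpace.NoetherianSpace X] (sX : X ⟶ B) [LocallyOfFiniteType sX]
    (sY : Y ⟶ B) (p : X ⟶ Y) [IsProper p] (hp : p ≫ sY = sX) (C : TopologicalSpace.Closeds X) :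
    ∃ (Z : Scheme) (q : Z ⟶ Y) (f : Z ⟶ X), IsProjectiveMorphism q ∧ f ≫ p = q ∧
      ∀ (W : Scheme) (ι : W ⟶ X), IsClosedImmersion ι → IsIntegral W → Set.range ι ⊆ C →
        HasBirationalLift f ι := by
  induction C using WellFoundedLT.induction with | ind C ih => ?_
  by_cases hC : IsPreirreducible (C : Set X)
  · obtain hC₀ | hC₀ := (C : Set X).eq_empty_or_nonempty
    · refine ⟨⊥_ Scheme, initial.to Y, initial.to X, ⟨0, initial.to _, inferInstance,
        initial.hom_ext _ _⟩, initial.hom_ext _ _, fun W ι _ _ h ↦ ?_⟩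
      rw [hC₀] at h
      exact (h ⟨genericPoint W, rfl⟩).elim
    · obtain ⟨W₀, ι₀, _, _, hr⟩ := exists_isIntegral_range_eq C.isClosed ⟨hC₀, hC⟩
      have : TopologicalSpace.NoetherianSpace W₀ :=
        ι₀.isClosedEmbedding.isEmbedding.isInducing.noetherianSpace
      have : W₀.IsSeparated := ⟨by rw [← terminal.comp_from ι₀]; infer_instance⟩
      obtain ⟨Z₀, q₀, f₀, hq₀, rfl, U, hU, s, hs⟩ :=
        exists_isProjectiveMorphism_of_isIntegral (ι₀ ≫ sX) sY (ι₀ ≫ p) (by rw [Category.assoc, hp])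
      have := hq₀.isProper
      have : IsSeparated f₀ := .of_comp f₀ (ι₀ ≫ p)
      let C' : TopologicalSpace.Closeds X :=
        ⟨ι₀ '' (U : Set W₀)ᶜ, ι₀.isClosedEmbedding.isClosedMap _ U.isOpen.isClosed_compl⟩
      have hlt : C' < C := by
        refine lt_of_le_of_ne ((Set.image_subset_range _ _).trans hr.le) fun h ↦ ?_
        obtain ⟨u⟩ := hU
        have hu : ι₀ u.1 ∈ (C' : Set X) := by
          rw [h, ← hr]
          exact ⟨_, rfl⟩
        obtain ⟨v, hv, hvu⟩ := hu
        exact hv (ι₀.isClosedEmbedding.injective hvu ▸ u.2)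
      obtain ⟨Z₁, q₁, f₁, hq₁, rfl, h₁⟩ := ih C' hlt
      refine ⟨Z₀ ⨿ Z₁, _, coprod.desc (f₀ ≫ ι₀) f₁, hq₀.coprodDesc hq₁, ?_,
        fun W ι _ _ h ↦ ?_⟩
      · ext <;> simp
      · obtain ⟨κ, rfl⟩ := IsClosedImmersion.exists_lift_of_isReduced ι₀ ι (h.trans hr.ge)
        by_cases hκ : Nonempty (κ ⁻¹ᵁ U)
        · have : IsClosedImmersion κ := .of_comp κ ι₀
          exact ((HasBirationalLift.of_section f₀ U s hs κ).comp_right ι₀).of_comp_eq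
            coprod.inl (coprod.inl_desc _ _)
        · refine (h₁ W _ inferInstance inferInstance ?_).of_comp_eq coprod.inr (coprod.inr_desc _ _)
          rintro _ ⟨w, rfl⟩
          exact ⟨κ w, fun hw ↦ hκ ⟨w, hw⟩, rfl⟩
  · simp only [isPreirreducible_iff_isClosed_union_isClosed, not_forall, not_or] at hC
    obtain ⟨C₁, C₂, hC₁, hC₂, hC, hn₁, hn₂⟩ := hC
    lift C₁ to TopologicalSpace.Closeds X using hC₁
    lift C₂ to TopologicalSpace.Closeds X using hC₂
    obtain ⟨Z₁, q₁, f₁, hq₁, rfl, h₁⟩ := ih (C ⊓ C₁) (inf_lt_left.2 hn₁)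
    obtain ⟨Z₂, q₂, f₂, hq₂, rfl, h₂⟩ := ih (C ⊓ C₂) (inf_lt_left.2 hn₂)
    refine ⟨Z₁ ⨿ Z₂, _, coprod.desc f₁ f₂, hq₁.coprodDesc hq₂, ?_, fun W ι _ _ h ↦ ?_⟩
    · ext <;> simp
    · have hirr : IsPreirreducible (Set.range ι) := by
        rw [← Set.image_univ]
        exact (IrreducibleSpace.isIrreducible_univ W).isPreirreducible.image _
          ι.continuous.continuousOn
      obtain h' | h' := isPreirreducible_iff_isClosed_union_isClosed.mp hirr C₁ C₂ C₁.isClosed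
        C₂.isClosed (h.trans hC)
      · exact (h₁ W ι inferInstance inferInstance (Set.subset_inter h h')).of_comp_eq coprod.inl
          (coprod.inl_desc _ _)
      · exact (h₂ W ι inferInstance inferInstance (Set.subset_inter h h')).of_comp_eq coprod.inr
          (coprod.inr_desc _ _)

/-- **Existence of projective envelopes (Chow's lemma + Noetherian induction).**
Every scheme `X` proper over a Noetherian base scheme `Y` (all schemes separated
of finite type over a field `k`) admits a projective envelope: there is a scheme
`Z`, projective over `Y`, together with an envelope `f : Z ⟶ X` over `Y`. -/
theorem exists_projective_envelope
    (k : Type) [Field k]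
    {X Y : Scheme} [AlgebraicGeometry.IsNoetherian Y]
    (sX : X ⟶ Spec (CommRingCat.of k)) (sY : Y ⟶ Spec (CommRingCat.of k))
    (hX : IsFiniteTypeOverField k sX) (hY : IsFiniteTypeOverField k sY)
    (p : X ⟶ Y) (hps : p ≫ sY = sX) [IsProper p] :
    ∃ (Z : Scheme) (q : Z ⟶ Y) (f : Z ⟶ X),
      IsProjectiveMorphism q ∧ f ≫ p = q ∧ IsEnvelope f := by
  obtain ⟨_, _, _⟩ := hX
  have : X.IsSeparated := ⟨by rw [← terminal.comp_from sX]; infer_instance⟩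
  have := LocallyOfFiniteType.isLocallyNoetherian p
  have : CompactSpace X := QuasiCompact.compactSpace_of_compactSpace p
  have : AlgebraicGeometry.IsNoetherian X := { }
  obtain ⟨Z, q, f, hq, rfl, h⟩ :=
    exists_isProjectiveMorphism_hasBirationalLift sX sY p hps ⊤
  have := hq.isProper
  exact ⟨Z, _, f, hq, rfl, .of_comp f p, fun W ι hι hW ↦ h W ι hι hW (Set.subset_univ _)⟩
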